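/- arXiv:1408.6823 — 2 statements merged into one kernel-verified Lean document; each statement's English description precedes it below -/
import Mathlib

section
/- Let a = a₁⋯aₙ ∈ 𝒜_{201,210}(n) and let x ∈ S_a with x > aₙ, and set a* = a₁⋯aₙx ∈ 𝒜_{201,210}(n+1). Then S_{a*} = S_a ∪ {max(S_a) + 1}, where max(S_a) denotes the largest element of the (finite, nonempty) set S_a. -/
/-- The number of ascents of the integer sequence `x`, i.e. the number of
positions `j` with `x j < x (j+1)`. -/
def numAscents (x : List ℕ) : ℕ :=
  ((List.zip x x.tail).filter (fun p => decide (p.1 < p.2))).length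

/-- `x` is an ascent sequence: it starts with `0` and each subsequent entry is
at most one more than the number of ascents of the preceding prefix. -/
def IsAscentSeq (x : List ℕ) : Prop :=
  x.head? = some 0 ∧
    ∀ i, 0 < i → i < x.length → x.getD i 0 ≤ numAscents (x.take i) + 1

/-- `x` contains the pattern `p`: some subsequence of `x` is order-isomorphic
to `p`. -/
def Contains (x p : List ℕ) : Prop :=
  ∃ u : List ℕ, u.Sublist x ∧ u.length = p.length ∧
    ∀ s t, s < p.length → t < p.length →
      (u.getD s 0 < u.getD t 0 ↔ p.getD s 0 < p.getD t 0) ∧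
      (u.getD s 0 = u.getD t 0 ↔ p.getD s 0 = p.getD t 0)

/-- `x` avoids the pattern `p`. -/
def Avoids (x p : List ℕ) : Prop := ¬ Contains x p

/-- The set `𝒜_B(n)` of ascent sequences of length `n` avoiding every pattern
in the list `B`. -/
def AvSet (B : List (List ℕ)) (n : ℕ) : Set (List ℕ) :=
  {x | x.length = n ∧ IsAscentSeq x ∧ ∀ p ∈ B, Avoids x p}

/-- `S_a`: the set of values `y` that may be appended to `a` so that the
result is an ascent sequence avoiding every pattern in `B`. -/
def Sset (B : List (List ℕ)) (a : List ℕ) : Set ℕ :=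
  {y | IsAscentSeq (a ++ [y]) ∧ ∀ p ∈ B, Avoids (a ++ [y]) p}

def Good (x : List ℕ) : Prop :=
  ∀ u v w, [u, v, w].Sublist x → v < u → w < u → v = w

theorem avoids_iff_good (x : List ℕ) :
    (∀ p ∈ [[2,0,1], [2,1,0]], Avoids x p) ↔ Good x := by
  constructor
  · intro h u v w hs h1 h2
    by_contra hne
    rcases Nat.lt_or_gt_of_ne hne with h3 | h3
    · refine h [2,0,1] (by simp) ⟨[u,v,w], hs, rfl, ?_⟩
      intro s t hs ht
      simp only [List.length_cons, List.length_nil] at hs ht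
      interval_cases s <;> interval_cases t <;> simp <;> omega
    · refine h [2,1,0] (by simp) ⟨[u,v,w], hs, rfl, ?_⟩
      intro s t hs ht
      simp only [List.length_cons, List.length_nil] at hs ht
      interval_cases s <;> interval_cases t <;> simp <;> omega
  · intro h p hp hc
    obtain ⟨l, hs, hl, hh⟩ := hc
    have hp3 : p.length = 3 := by
      simp at hp
      rcases hp with rfl | rfl <;> rfl
    rw [hp3] at hl
    obtain ⟨u, v, w, rfl⟩ := List.length_eq_three.1 hl
    have h10 := hh 1 0 (by omega) (by omega)
    have h20 := hh 2 0 (by omega) (by omega)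
    have h12 := hh 1 2 (by omega) (by omega)
    have := h u v w hs
    simp at hp
    rcases hp with rfl | rfl <;> simp at h10 h20 h12 <;> omega

theorem good_append (a : List ℕ) (y : ℕ) :
    Good (a ++ [y]) ↔ Good a ∧ ∀ u v, [u, v].Sublist a → v < u → y < u → v = y := by
  constructor
  · intro h
    refine ⟨fun u v w hs => h u v w (hs.trans (List.sublist_append_left _ _)), ?_⟩
    intro u v hs
    exact h u v y (List.Sublist.append hs (List.Sublist.refl [y]))
  · rintro ⟨h1, h2⟩ u v w hs
    rw [← List.reverse_sublist] at hs
    simp only [List.reverse_append, List.reverse_cons, List.reverse_nil, List.nil_append,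
      List.cons_append] at hs
    rw [List.cons_sublist_cons'] at hs
    rcases hs with hs | ⟨rfl, hs⟩
    · exact h1 u v w (by rw [← List.reverse_sublist]; simpa using hs)
    · exact h2 u v (by rw [← List.reverse_sublist]; simpa using hs)

theorem pair_append (a : List ℕ) (y u v : ℕ) (hs : [u, v].Sublist (a ++ [y])) :
    [u, v].Sublist a ∨ (v = y ∧ u ∈ a) := by
  rw [← List.reverse_sublist] at hs
  simp only [List.reverse_append, List.reverse_cons, List.reverse_nil, List.nil_append,
    List.cons_append] at hs
  rw [List.cons_sublist_cons'] at hs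
  rcases hs with hs | ⟨rfl, hs⟩
  · left
    rw [← List.reverse_sublist]; simpa using hs
  · right
    simpa using hs

theorem numAscents_append (a : List ℕ) (ha : a ≠ []) (y : ℕ) :
    numAscents (a ++ [y]) = numAscents a + if a.getLastD 0 < y then 1 else 0 := by
  induction a with
  | nil => exact absurd rfl ha
  | cons p l ih =>
    cases l with
    | nil => by_cases h : p < y <;> simp [numAscents, h]
    | cons q l =>
      have := ih (by simp)
      by_cases h : p < q <;> simp [numAscents, h] at this ⊢ <;> omega

theorem ascent_append (a : List ℕ) (ha : a ≠ []) (y : ℕ) :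
    IsAscentSeq (a ++ [y]) ↔ IsAscentSeq a ∧ y ≤ numAscents a + 1 := by
  have hpos : 0 < a.length := List.length_pos_iff.2 ha
  have hh : (a ++ [y]).head? = a.head? := by
    cases a with
    | nil => exact absurd rfl ha
    | cons p l => rfl
  unfold IsAscentSeq
  rw [hh]
  constructor
  · rintro ⟨h0, h⟩
    refine ⟨⟨h0, fun i hi hl => ?_⟩, ?_⟩
    · have := h i hi (by simp; omega)
      rwa [List.getD_append _ _ _ _ hl, List.take_append_of_le_length hl.le] at this
    · have := h a.length hpos (by simp)
      simpa using this
  · rintro ⟨⟨h0, h⟩, hy⟩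
    refine ⟨h0, fun i hi hl => ?_⟩
    simp at hl
    rcases Nat.lt_or_ge i a.length with hl' | hl'
    · rw [List.getD_append _ _ _ _ hl', List.take_append_of_le_length hl'.le]
      exact h i hi hl'
    · obtain rfl : i = a.length := by omega
      simpa using hy

theorem ascent_bound (a : List ℕ) : IsAscentSeq a → ∀ z ∈ a, z ≤ numAscents a + 1 := by
  induction a using List.reverseRecOn with
  | nil => simp
  | append_singleton b y ih =>
    intro h z hz
    by_cases hb : b = []
    · subst hb
      have := h.1
      simp at this hz
      omega
    · rw [ascent_append b hb] at h
      rw [numAscents_append b hb]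
      simp at hz
      rcases hz with hz | rfl
      · have := ih h.1 z hz
        omega
      · omega

theorem mem_Sset (a : List ℕ) (ha : a ≠ []) (h1 : IsAscentSeq a) (h2 : Good a) (y : ℕ) :
    y ∈ Sset [[2,0,1], [2,1,0]] a ↔ y ≤ numAscents a + 1 ∧
      ∀ u v, [u, v].Sublist a → v < u → y < u → v = y := by
  unfold Sset
  rw [Set.mem_setOf_eq, avoids_iff_good, good_append, ascent_append a ha]
  tauto

theorem isGreatest_Sset (a : List ℕ) (ha : a ≠ []) (h1 : IsAscentSeq a) (h2 : Good a) :
    IsGreatest (Sset [[2,0,1], [2,1,0]] a) (numAscents a + 1) := by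
  constructor
  · rw [mem_Sset a ha h1 h2]
    refine ⟨le_rfl, fun u v hs _ h => ?_⟩
    have := ascent_bound a h1 u (hs.subset (by simp))
    omega
  · intro y hy
    exact ((mem_Sset a ha h1 h2 y).1 hy).1

theorem last_pair (a : List ℕ) (u x : ℕ) (hu : u ∈ a) (h : a.getLastD 0 < x) (hxu : x < u) :
    [u, a.getLastD 0].Sublist a := by
  induction a using List.reverseRecOn with
  | nil => simp at hu
  | append_singleton b y _ =>
    simp at hu h ⊢
    rcases hu with hu | rfl
    · exact List.Sublist.append (List.singleton_sublist.2 hu) (List.Sublist.refl [y])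
    · omega

/-- appending `x > aₙ` (an ascent) yields
`S_{a*} = S_a ∪ {max S_a + 1}`. -/
theorem Sset_append_ascent (n : ℕ) (hn : 1 ≤ n) (a : List ℕ)
    (ha : a ∈ AvSet [[2,0,1], [2,1,0]] n) (x : ℕ)
    (hx : x ∈ Sset [[2,0,1], [2,1,0]] a) (hgt : a.getLastD 0 < x) :
    Sset [[2,0,1], [2,1,0]] (a ++ [x]) =
      Sset [[2,0,1], [2,1,0]] a ∪ {sSup (Sset [[2,0,1], [2,1,0]] a) + 1} := by
  obtain ⟨hl, h1, h2⟩ := ha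
  rw [avoids_iff_good] at h2
  have hne : a ≠ [] := by
    rintro rfl
    simp at hl
    omega
  have hx1 : IsAscentSeq (a ++ [x]) := hx.1
  have hx2 : Good (a ++ [x]) := (avoids_iff_good _).1 hx.2
  have hx' := (mem_Sset a hne h1 h2 x).1 hx
  have hasc := numAscents_append a hne x
  rw [if_pos hgt] at hasc
  have hg := isGreatest_Sset (a ++ [x]) (by simp) hx1 hx2
  rw [(isGreatest_Sset a hne h1 h2).csSup_eq]
  rw [hasc] at hg
  ext y
  rw [Set.mem_union, Set.mem_singleton_iff]
  constructor
  · intro hy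
    have hy' := (mem_Sset _ (by simp) hx1 hx2 y).1 hy
    rw [hasc] at hy'
    by_cases h : y = numAscents a + 1 + 1
    · exact Or.inr h
    · left
      rw [mem_Sset a hne h1 h2]
      exact ⟨by omega, fun u v hs => hy'.2 u v (hs.trans (List.sublist_append_left _ _))⟩
  · rintro (hy | rfl)
    · have hy' := (mem_Sset a hne h1 h2 y).1 hy
      rw [mem_Sset _ (by simp) hx1 hx2, hasc]
      refine ⟨by omega, fun u v hs hvu hyu => ?_⟩
      rcases pair_append a x u v hs with hs | ⟨rfl, hu⟩
      · exact hy'.2 u v hs hvu hyu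
      · have := hx'.2 u _ (last_pair a u v hu hgt hvu) (by omega) hvu
        omega
    · exact hg.1
end

section
/- Let a = a₁⋯aₙ ∈ 𝒜_{201,210}(n) and set a* = a₁⋯aₙaₙ, the extension of a by repeating its last digit. Then S_{a*} = S_a. -/
theorem numAscents_cons_cons (x y : ℕ) (t : List ℕ) :
    numAscents (x :: y :: t) = (if x < y then 1 else 0) + numAscents (y :: t) := by
  unfold numAscents
  by_cases h : x < y <;> simp [h]
  omega

theorem numAscents_snoc (b : List ℕ) (l m : ℕ) :
    numAscents (b ++ [l, m]) = numAscents (b ++ [l]) + if l < m then 1 else 0 := by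
  induction b with
  | nil => simp [numAscents_cons_cons]; simp [numAscents]
  | cons x t ih =>
    cases t with
    | nil => simp only [List.cons_append, List.nil_append, numAscents_cons_cons] at *; omega
    | cons y t => simp only [List.cons_append, numAscents_cons_cons] at *; omega

theorem isAscentSeq_snoc (x : List ℕ) (hx : x ≠ []) (y : ℕ) :
    IsAscentSeq (x ++ [y]) ↔ IsAscentSeq x ∧ y ≤ numAscents x + 1 := by
  have hl : 0 < x.length := List.length_pos_iff.2 hx
  have hh : (x ++ [y]).head? = x.head? := by
    cases x with
    | nil => exact absurd rfl hx
    | cons _ _ => rfl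
  unfold IsAscentSeq
  rw [hh]
  constructor
  · rintro ⟨h0, h⟩
    refine ⟨⟨h0, fun i hi hil => ?_⟩, ?_⟩
    · have := h i hi (by simp; omega)
      rwa [List.getD_append _ _ _ _ hil, List.take_append_of_le_length hil.le] at this
    · have := h x.length hl (by simp)
      simpa using this
  · rintro ⟨⟨h0, h⟩, hy⟩
    refine ⟨h0, fun i hi hil => ?_⟩
    by_cases hlt : i < x.length
    · rw [List.getD_append _ _ _ _ hlt, List.take_append_of_le_length hlt.le]
      exact h i hi hlt
    · have : i = x.length := by simp at hil; omega
      subst this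
      simpa using hy

theorem last_le (b : List ℕ) (l : ℕ) (h : IsAscentSeq (b ++ [l])) :
    l ≤ numAscents (b ++ [l]) + 1 := by
  rcases List.eq_nil_or_concat b with rfl | ⟨c, k, rfl⟩
  · have : l = 0 := by simpa using h.1
    omega
  · have h2 := ((isAscentSeq_snoc _ (by simp) l).1 h).2
    have h3 := numAscents_snoc c k l
    simp only [List.concat_eq_append, List.append_assoc, List.cons_append, List.nil_append] at *
    omega

theorem nodup_sublist (b u : List ℕ) (l y : ℕ) (hu : u.Nodup)
    (h : u.Sublist (b ++ [l, l, y])) : u.Sublist (b ++ [l, y]) := by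
  obtain ⟨u1, u2, rfl, h1, h2⟩ := List.sublist_append_iff.1 h
  refine h1.append ?_
  have hn : u2.Nodup := hu.of_append_right
  rcases List.sublist_cons_iff.1 h2 with h3 | ⟨r, rfl, h3⟩
  · exact h3
  · rcases List.sublist_cons_iff.1 h3 with h4 | ⟨q, rfl, h4⟩
    · exact h4.cons_cons _
    · simp at hn

theorem contains_iff (b p : List ℕ) (l y : ℕ) (hp : p.Nodup) :
    Contains (b ++ [l, l, y]) p ↔ Contains (b ++ [l, y]) p := by
  constructor
  · rintro ⟨u, hs, hl, h⟩
    refine ⟨u, nodup_sublist b u l y ?_ hs, hl, h⟩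
    rw [List.nodup_iff_injective_get]
    rintro ⟨i, hi⟩ ⟨j, hj⟩ hij
    have h1 := (h i j (by omega) (by omega)).2.1
      (by rw [List.getD_eq_getElem _ _ hi, List.getD_eq_getElem _ _ hj]; exact hij)
    have hi' : i < p.length := by omega
    have hj' : j < p.length := by omega
    rw [List.getD_eq_getElem _ _ hi', List.getD_eq_getElem _ _ hj'] at h1
    have := (hp.getElem_inj_iff).1 h1
    simpa using this
  · rintro ⟨u, hs, hl, h⟩
    exact ⟨u, hs.trans ((List.Sublist.refl b).append (List.sublist_cons_self _ _)), hl, h⟩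

/-- repeating the last digit leaves `S_a` unchanged:
`S_{a*} = S_a`. -/
theorem Sset_append_repeat (n : ℕ) (hn : 1 ≤ n) (a : List ℕ)
    (ha : a ∈ AvSet [[2,0,1], [2,1,0]] n) :
    Sset [[2,0,1], [2,1,0]] (a ++ [a.getLastD 0]) = Sset [[2,0,1], [2,1,0]] a := by
  obtain ⟨hlen, hasc, -⟩ := ha
  rcases List.eq_nil_or_concat a with rfl | ⟨b, l, rfl⟩
  · simp at hlen; omega
  simp only [List.concat_eq_append] at *
  have hg : (b ++ [l]).getLastD 0 = l := by simp
  rw [hg]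
  ext y
  have hA : IsAscentSeq (b ++ [l] ++ [l] ++ [y]) ↔ IsAscentSeq (b ++ [l] ++ [y]) := by
    rw [isAscentSeq_snoc (b ++ [l] ++ [l]) (by simp), isAscentSeq_snoc (b ++ [l]) (by simp) l,
      isAscentSeq_snoc (b ++ [l]) (by simp) y]
    have h1 := last_le b l hasc
    have h2 := numAscents_snoc b l l
    simp only [lt_irrefl, if_false, add_zero] at h2
    have h3 : b ++ [l] ++ [l] = b ++ [l, l] := by simp
    rw [h3, h2]
    tauto
  have hC : ∀ p ∈ [[2,0,1], [2,1,0]],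
      (Avoids (b ++ [l] ++ [l] ++ [y]) p ↔ Avoids (b ++ [l] ++ [y]) p) := by
    intro p hp
    have hn : p.Nodup := by
      simp only [List.mem_cons, List.not_mem_nil, or_false] at hp
      rcases hp with rfl | rfl <;> decide
    have := contains_iff b p l y hn
    simp only [Avoids, List.append_assoc, List.cons_append, List.nil_append]
    exact not_congr this
  unfold Sset
  simp only [Set.mem_ofPred_eq]
  rw [hA]
  exact and_congr_right fun _ => forall₂_congr hC
end
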